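/- Let Z be a real m × k matrix, X a real m × d matrix, and c ∈ ℝ^m. Define A_a := Xᵀ·X + I_d, B := Xᵀ·Z (a d × k matrix), b := Xᵀ·c, A₀ := Zᵀ·Z + I_k − Bᵀ·A_a⁻¹·B, and b₀ := Zᵀ·c − Bᵀ·A_a⁻¹·b. Then the block matrix M := fromBlocks (Zᵀ·Z + I_k) (Zᵀ·X) (Xᵀ·Z) (Xᵀ·X + I_d) is positive definite, A₀ is positive definite (hence both are invertible), and the pair β̂ := A₀⁻¹·b₀, θ̂ := A_a⁻¹·(b − B·β̂) is the unique solution of the normal equations M·(β, θ) = (Zᵀ·c, Xᵀ·c); equivalently, (β̂, θ̂) is the unique minimizer over (β, θ) ∈ ℝ^k × ℝ^d of ‖Z·β + X·θ − c‖² + ‖β‖² + ‖θ‖². -/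

import Mathlib

open Matrix

theorem sum_add_sq {ι : Type*} [Fintype ι] (x y : ι → ℝ) :
    ∑ i, (x + y) i ^ 2 = ∑ i, x i ^ 2 + 2 * (x ⬝ᵥ y) + ∑ i, y i ^ 2 := by
  simp only [dotProduct, Finset.mul_sum, ← Finset.sum_add_distrib, Pi.add_apply]
  exact Finset.sum_congr rfl fun i _ => by ring

/-- The ridge-regression Gram matrix `Wᵀ * W + 1` is positive definite. -/
theorem posDef_transpose_mul_self_add_one {m n : Type*} [Fintype m] [Fintype n] [DecidableEq n]
    (W : Matrix m n ℝ) : (Wᵀ * W + 1).PosDef := by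
  have h : (Wᵀ * W).PosSemidef := by
    simpa [conjTranspose_eq_transpose_of_trivial] using posSemidef_conjTranspose_mul_self W
  exact PosDef.posSemidef_add h PosDef.one

/-- If `v` solves the ridge normal equations, the ridge objective at `w` exceeds its value at `v`
by `‖W (w - v)‖² + ‖w - v‖²`. -/
theorem ridge_objective_eq_add {m n : Type*} [Fintype m] [Fintype n] [DecidableEq n]
    (W : Matrix m n ℝ) (c : m → ℝ) (v w : n → ℝ) (hv : (Wᵀ * W + 1) *ᵥ v = Wᵀ *ᵥ c) :
    ∑ i, (W *ᵥ w - c) i ^ 2 + ∑ j, w j ^ 2 =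
      (∑ i, (W *ᵥ v - c) i ^ 2 + ∑ j, v j ^ 2) +
        (∑ i, (W *ᵥ (w - v)) i ^ 2 + ∑ j, (w - v) j ^ 2) := by
  have orth : (W *ᵥ v - c) ⬝ᵥ (W *ᵥ (w - v)) + v ⬝ᵥ (w - v) = 0 := by
    rw [dotProduct_mulVec, ← mulVec_transpose, ← add_dotProduct, mulVec_sub, ← hv, add_mulVec,
      one_mulVec, mulVec_mulVec]
    simp
  have hW : W *ᵥ w - c = (W *ᵥ v - c) + W *ᵥ (w - v) := by rw [mulVec_sub]; abel
  have hw : ∑ j, w j ^ 2 = ∑ j, (v + (w - v)) j ^ 2 := by simp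
  rw [hW, hw, sum_add_sq, sum_add_sq]
  linarith

/-- The Schur complement of `Xᵀ * X + 1` in the hybrid ridge-regression Gram matrix is positive
definite. -/
theorem posDef_ridge_schurComplement {m k d : Type*} [Fintype m] [Fintype k] [Fintype d]
    [DecidableEq k] [DecidableEq d] (Z : Matrix m k ℝ) (X : Matrix m d ℝ) :
    (Zᵀ * Z + 1 - (Xᵀ * Z)ᵀ * (Xᵀ * X + 1)⁻¹ * (Xᵀ * Z)).PosDef := by
  have hA := posDef_transpose_mul_self_add_one X
  let : Invertible (Xᵀ * X + 1) := hA.isUnit.invertible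
  have h1 : (fromBlocks (Zᵀ * Z) (Zᵀ * X) (Zᵀ * X)ᴴ (Xᵀ * X + 1)).PosSemidef := by
    have h2 : ((fromCols Z X)ᴴ * fromCols Z X).PosSemidef := posSemidef_conjTranspose_mul_self _
    have h3 : ((fromCols (0 : Matrix d k ℝ) (1 : Matrix d d ℝ))ᴴ *
        fromCols (0 : Matrix d k ℝ) (1 : Matrix d d ℝ)).PosSemidef :=
      posSemidef_conjTranspose_mul_self _
    convert h2.add h3 using 1
    simp only [conjTranspose_eq_transpose_of_trivial, transpose_fromCols, fromRows_mul_fromCols,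
      fromBlocks_add]
    simp
  have h4 := (PosDef.fromBlocks₂₂ (Zᵀ * Z) (Zᵀ * X) hA).1 h1
  have h5 : Zᵀ * Z + 1 - (Xᵀ * Z)ᵀ * (Xᵀ * X + 1)⁻¹ * (Xᵀ * Z) =
      Zᵀ * Z - Zᵀ * X * (Xᵀ * X + 1)⁻¹ * (Zᵀ * X)ᴴ + 1 := by
    simp only [conjTranspose_eq_transpose_of_trivial, transpose_mul, transpose_transpose]
    abel
  exact h5 ▸ PosDef.posSemidef_add h4 PosDef.one

/-- Ridge regression for the hybrid linear model.  With
`A_a = Xᵀ·X + I_d`, `B = Xᵀ·Z`, `b = Xᵀ·c`, `A₀ = Zᵀ·Z + I_k − Bᵀ·A_a⁻¹·B`,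
`b₀ = Zᵀ·c − Bᵀ·A_a⁻¹·b`, the joint regularized Gram block matrix
`M = fromBlocks (Zᵀ·Z + I_k) (Zᵀ·X) (Xᵀ·Z) (Xᵀ·X + I_d)` is positive definite,
`A₀` is positive definite, and `β̂ = A₀⁻¹·b₀`, `θ̂ = A_a⁻¹·(b − B·β̂)` form the
unique solution of the normal equations `M·(β,θ) = (Zᵀ·c, Xᵀ·c)`; equivalently,
`(β̂, θ̂)` is the unique minimizer of `‖Z·β + X·θ − c‖² + ‖β‖² + ‖θ‖²`. -/
theorem hybrid_ridge_regression
    (m k d : ℕ) (Z : Matrix (Fin m) (Fin k) ℝ) (X : Matrix (Fin m) (Fin d) ℝ)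
    (c : Fin m → ℝ)
    (Aa : Matrix (Fin d) (Fin d) ℝ) (hAa : Aa = Xᵀ * X + 1)
    (B : Matrix (Fin d) (Fin k) ℝ) (hB : B = Xᵀ * Z)
    (b : Fin d → ℝ) (hb : b = Xᵀ *ᵥ c)
    (A0 : Matrix (Fin k) (Fin k) ℝ) (hA0 : A0 = Zᵀ * Z + 1 - Bᵀ * Aa⁻¹ * B)
    (b0 : Fin k → ℝ) (hb0 : b0 = Zᵀ *ᵥ c - Bᵀ *ᵥ (Aa⁻¹ *ᵥ b))
    (M : Matrix (Fin k ⊕ Fin d) (Fin k ⊕ Fin d) ℝ)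
    (hM : M = fromBlocks (Zᵀ * Z + 1) (Zᵀ * X) (Xᵀ * Z) (Xᵀ * X + 1))
    (βhat : Fin k → ℝ) (hβ : βhat = A0⁻¹ *ᵥ b0)
    (θhat : Fin d → ℝ) (hθ : θhat = Aa⁻¹ *ᵥ (b - B *ᵥ βhat)) :
    M.PosDef ∧ A0.PosDef ∧
    (M *ᵥ Sum.elim βhat θhat = Sum.elim (Zᵀ *ᵥ c) (Xᵀ *ᵥ c)) ∧
    (∀ (β : Fin k → ℝ) (θ : Fin d → ℝ),
      M *ᵥ Sum.elim β θ = Sum.elim (Zᵀ *ᵥ c) (Xᵀ *ᵥ c) → β = βhat ∧ θ = θhat) ∧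
    (∀ (β : Fin k → ℝ) (θ : Fin d → ℝ),
      ((∑ i, (Z *ᵥ βhat + X *ᵥ θhat - c) i ^ 2 + ∑ j, βhat j ^ 2 + ∑ j, θhat j ^ 2)
        ≤ (∑ i, (Z *ᵥ β + X *ᵥ θ - c) i ^ 2 + ∑ j, β j ^ 2 + ∑ j, θ j ^ 2)) ∧
      ((∑ i, (Z *ᵥ β + X *ᵥ θ - c) i ^ 2 + ∑ j, β j ^ 2 + ∑ j, θ j ^ 2)
          = (∑ i, (Z *ᵥ βhat + X *ᵥ θhat - c) i ^ 2 + ∑ j, βhat j ^ 2 + ∑ j, θhat j ^ 2)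
        → β = βhat ∧ θ = θhat)) := by
  have hAaPD : Aa.PosDef := hAa ▸ posDef_transpose_mul_self_add_one X
  have hA0PD : A0.PosDef := by
    rw [hA0, hB, hAa]
    exact posDef_ridge_schurComplement Z X
  have hMW : M = (fromCols Z X)ᵀ * fromCols Z X + 1 := by
    rw [hM, transpose_fromCols, fromRows_mul_fromCols, ← fromBlocks_one, fromBlocks_add]
    simp
  have hMPD : M.PosDef := hMW ▸ posDef_transpose_mul_self_add_one _
  have hA0mul : A0 *ᵥ βhat = b0 := by
    rw [hβ, mulVec_mulVec, mul_nonsing_inv _ ((isUnit_iff_isUnit_det _).1 hA0PD.isUnit),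
      one_mulVec]
  have hAamul : Aa *ᵥ θhat = b - B *ᵥ βhat := by
    rw [hθ, mulVec_mulVec, mul_nonsing_inv _ ((isUnit_iff_isUnit_det _).1 hAaPD.isUnit),
      one_mulVec]
  have hBT : Zᵀ * X = Bᵀ := by simp [hB]
  have hsol : M *ᵥ Sum.elim βhat θhat = Sum.elim (Zᵀ *ᵥ c) (Xᵀ *ᵥ c) := by
    rw [hM, fromBlocks_mulVec, Sum.elim_comp_inl, Sum.elim_comp_inr]
    congr 1
    · have hsplit : Zᵀ * Z + 1 = A0 + Bᵀ * Aa⁻¹ * B := by rw [hA0]; abel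
      rw [hsplit, add_mulVec, hA0mul, hb0, hBT, hθ]
      simp only [mulVec_sub, mulVec_mulVec, Matrix.mul_assoc]
      abel
    · rw [← hAa, hAamul, ← hB, ← hb]
      abel
  have hobj : ∀ (β : Fin k → ℝ) (θ : Fin d → ℝ),
      ∑ i, (Z *ᵥ β + X *ᵥ θ - c) i ^ 2 + ∑ j, β j ^ 2 + ∑ j, θ j ^ 2 =
        ∑ i, (fromCols Z X *ᵥ Sum.elim β θ - c) i ^ 2 + ∑ j, Sum.elim β θ j ^ 2 := by
    intro β θ
    simp [fromCols_mulVec, Fintype.sum_sum_type, add_assoc]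
  have helim : ∀ (β : Fin k → ℝ) (θ : Fin d → ℝ),
      Sum.elim β θ = Sum.elim βhat θhat → β = βhat ∧ θ = θhat := fun β θ h =>
    ⟨funext fun i => congrFun h (Sum.inl i), funext fun i => congrFun h (Sum.inr i)⟩
  refine ⟨hMPD, hA0PD, hsol, fun β θ h => ?_, fun β θ => ?_⟩
  · exact helim β θ (mulVec_injective_of_isUnit hMPD.isUnit (h.trans hsol.symm))
  · have key := ridge_objective_eq_add (fromCols Z X) c (Sum.elim βhat θhat) (Sum.elim β θ) (by
      rw [← hMW, hsol, transpose_fromCols, fromRows_mulVec])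
    rw [hobj, hobj, key]
    have h1 : 0 ≤ ∑ i, (fromCols Z X *ᵥ (Sum.elim β θ - Sum.elim βhat θhat)) i ^ 2 :=
      Finset.sum_nonneg fun i _ => sq_nonneg _
    have h2 : 0 ≤ ∑ j, (Sum.elim β θ - Sum.elim βhat θhat) j ^ 2 :=
      Finset.sum_nonneg fun i _ => sq_nonneg _
    refine ⟨by linarith, fun h => helim β θ ?_⟩
    have h3 : ∑ j, (Sum.elim β θ - Sum.elim βhat θhat) j ^ 2 = 0 := by linarith
    rw [Finset.sum_eq_zero_iff_of_nonneg fun i _ => sq_nonneg _] at h3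
    exact sub_eq_zero.1 (funext fun j => pow_eq_zero_iff two_ne_zero |>.1 (h3 j (Finset.mem_univ j)))
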